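/- arXiv:2009.12612 — 3 statements merged into one kernel-verified Lean document; each statement's English description precedes it below -/
import Mathlib

section
/- Let S be a type of states and A a type of actions, P : S → A → Set S the worst-case transition bound, g : S → A a shield with invariant φ ⊆ S (i.e. P s (g s) ⊆ φ for all s ∈ φ), S₀ ⊆ φ an initial set, and U an unsafe set with φ ∩ U = ∅. For ANY policy f : S → A, define the shielded policy h s = if P s (f s) ⊆ φ then f s else g s, and define reach : ℕ → Set S by reach 0 = S₀ and reach (n+1) = ⋃ s ∈ reach n, P s (h s). Then reach n ⊆ φ and reach n ∩ U = ∅ for every n. In particular, every gradient update to the neural component f preserves worst-case safety of the shielded policy. -/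
/-- For any neural policy `f`, the shielded policy
`h s = if P s (f s) ⊆ φ then f s else g s` keeps all reachable states inside the
invariant `φ`, hence away from the unsafe set `U`: gradient updates to `f`
preserve worst-case safety. -/
theorem shielded_policy_reach_safe {S A : Type*}
    (P : S → A → Set S) (g : S → A) (φ S₀ U : Set S)
    (hg : ∀ s ∈ φ, P s (g s) ⊆ φ)
    (hinit : S₀ ⊆ φ)
    (hsafe : φ ∩ U = ∅)
    (f : S → A)
    [∀ s, Decidable (P s (f s) ⊆ φ)]
    (h : S → A)
    (hdef : ∀ s, h s = if P s (f s) ⊆ φ then f s else g s)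
    (reach : ℕ → Set S)
    (hreach0 : reach 0 = S₀)
    (hreachSucc : ∀ n, reach (n + 1) = ⋃ s ∈ reach n, P s (h s)) :
    ∀ n, reach n ⊆ φ ∧ reach n ∩ U = ∅ := by
  have hstep : ∀ s ∈ φ, P s (h s) ⊆ φ := by
    intro s hs
    rw [hdef s]
    split_ifs with hf
    · exact hf
    · exact hg s hs
  have hreach : ∀ n, reach n ⊆ φ := by
    intro n
    induction n with
    | zero => exact hreach0.trans_subset hinit
    | succ n ih =>
      rw [hreachSucc]
      exact Set.iUnion₂_subset fun s hs => hstep s (ih hs)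
  intro n
  exact ⟨hreach n, Set.subset_eq_empty (Set.inter_subset_inter_left U (hreach n)) hsafe⟩
end

section
/- Let (Ω, μ) be a probability space, Z : Ω → ℝ a measurable random variable with Z ω ∈ {0, 1} for μ-almost every ω, and X : Ω → ℝ a measurable random variable with |X ω| ≤ K for μ-almost every ω (where K ≥ 0). Then |E[Z·X] − E[Z]·E[X]| ≤ K / 2. -/
open MeasureTheory ProbabilityTheory

/-- The covariance of an a.s. `{0,1}`-valued random variable `Z` with an a.s.
bounded random variable `X` is at most `K / 2` in absolute value. -/
theorem indicator_covariance_bound {Ω : Type*} [MeasurableSpace Ω]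
    (μ : Measure Ω) [IsProbabilityMeasure μ]
    (Z X : Ω → ℝ) (hZ : Measurable Z) (hX : Measurable X)
    (hind : ∀ᵐ ω ∂μ, Z ω = 0 ∨ Z ω = 1)
    (K : ℝ) (hK : 0 ≤ K)
    (hbound : ∀ᵐ ω ∂μ, |X ω| ≤ K) :
    |(∫ ω, Z ω * X ω ∂μ) - (∫ ω, Z ω ∂μ) * (∫ ω, X ω ∂μ)| ≤ K / 2 := by
  have hX_int : Integrable X μ := .of_bound hX.aestronglyMeasurable K hbound
  have hZ_int : Integrable Z μ := .of_bound hZ.aestronglyMeasurable 1 <| by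
    filter_upwards [hind] with ω h
    rcases h with h | h <;> simp [h]
  have hZX_int : Integrable (fun ω ↦ Z ω * X ω) μ :=
    .of_bound (hZ.mul hX).aestronglyMeasurable K <| by
      filter_upwards [hind, hbound] with ω h hx
      rcases h with h | h <;> simp [h, hK, hx]
  have abs_integral_mul_le : |∫ ω, Z ω * X ω ∂μ| ≤ K * ∫ ω, Z ω ∂μ := by
    rw [← integral_const_mul, ← Real.norm_eq_abs]
    refine norm_integral_le_of_norm_le (hZ_int.const_mul K) ?_
    filter_upwards [hind, hbound] with ω h hx
    rcases h with h | h <;> simp [h, hx]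
  have abs_integral_compl_le :
      |(∫ ω, X ω ∂μ) - ∫ ω, Z ω * X ω ∂μ| ≤ K * (1 - ∫ ω, Z ω ∂μ) := by
    have hcompl_int : Integrable (fun ω ↦ K * (1 - Z ω)) μ :=
      ((integrable_const 1).sub hZ_int).const_mul K
    have hcompl : ∫ ω, K * (1 - Z ω) ∂μ = K * (1 - ∫ ω, Z ω ∂μ) := by
      rw [integral_const_mul, integral_sub (integrable_const 1) hZ_int]
      simp
    rw [← integral_sub hX_int hZX_int, ← hcompl, ← Real.norm_eq_abs]
    refine norm_integral_le_of_norm_le hcompl_int ?_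
    filter_upwards [hind, hbound] with ω h hx
    rcases h with h | h <;> simp [h, hx]
  have hp0 : 0 ≤ ∫ ω, Z ω ∂μ := integral_nonneg_of_ae <| by
    filter_upwards [hind] with ω h
    rcases h with h | h <;> simp [h]
  have hp1 : ∫ ω, Z ω ∂μ ≤ 1 := by
    have h := integral_mono_ae hZ_int (integrable_const (1 : ℝ)) <| by
      filter_upwards [hind] with ω h
      rcases h with h | h <;> simp [h]
    simpa using h
  generalize (∫ ω, Z ω ∂μ) = p at *
  generalize (∫ ω, Z ω * X ω ∂μ) = a at *
  generalize (∫ ω, X ω ∂μ) = m at *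
  calc |a - p * m| = |(1 - p) * a - p * (m - a)| := by ring_nf
    _ ≤ |(1 - p) * a| + |p * (m - a)| := abs_sub _ _
    _ = (1 - p) * |a| + p * |m - a| := by
      rw [abs_mul, abs_mul, abs_of_nonneg hp0, abs_of_nonneg (sub_nonneg.2 hp1)]
    _ ≤ (1 - p) * (K * p) + p * (K * (1 - p)) := by
      have := sub_nonneg.2 hp1
      gcongr
    _ ≤ K / 2 := by nlinarith [mul_nonneg hK (sq_nonneg (2 * p - 1))]
end

section
/- Let E be a real inner product space (with Bochner-integrable functions defined via its norm), (Ω, μ) a probability space, Z : Ω → ℝ a measurable random variable with Z ω ∈ {0, 1} for μ-almost every ω, and G : Ω → E a Bochner-integrable random vector with ‖G ω‖ ≤ K for μ-almost every ω (where K ≥ 0). Then the covariance vector satisfies ‖E[Z • G] − E[Z] • E[G]‖ ≤ K / 2, where • denotes scalar multiplication and E denotes the Bochner integral. -/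
open MeasureTheory

/-- Vector-valued covariance bound: for an a.s. `{0,1}`-valued indicator `Z`
and a Bochner-integrable random vector `G` bounded in norm by `K`, the
covariance vector `E[Z • G] − E[Z] • E[G]` has norm at most `K / 2`. -/
theorem indicator_covariance_vector_bound {Ω : Type*} [MeasurableSpace Ω]
    (μ : Measure Ω) [IsProbabilityMeasure μ]
    {E : Type*} [NormedAddCommGroup E] [InnerProductSpace ℝ E] [CompleteSpace E]
    (Z : Ω → ℝ) (hZ : Measurable Z)
    (hind : ∀ᵐ ω ∂μ, Z ω = 0 ∨ Z ω = 1)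
    (G : Ω → E) (hG : Integrable G μ)
    (K : ℝ) (hK : 0 ≤ K)
    (hbound : ∀ᵐ ω ∂μ, ‖G ω‖ ≤ K) :
    ‖(∫ ω, Z ω • G ω ∂μ) - (∫ ω, Z ω ∂μ) • (∫ ω, G ω ∂μ)‖ ≤ K / 2 := by
  set p := ∫ ω, Z ω ∂μ with hp
  have hZint : Integrable Z μ :=
    Integrable.of_bound hZ.aestronglyMeasurable 1 <| by
      filter_upwards [hind] with ω h
      rcases h with h | h <;> simp [h]
  have hp0 : 0 ≤ p := integral_nonneg_of_ae <| by
    filter_upwards [hind] with ω h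
    rcases h with h | h <;> simp [h]
  have hp1 : p ≤ 1 := by
    have h : p ≤ ∫ _, (1 : ℝ) ∂μ := integral_mono_ae hZint (integrable_const 1) <| by
      filter_upwards [hind] with ω h
      rcases h with h | h <;> simp [h]
    simpa using h
  have hZG : Integrable (fun ω => Z ω • G ω) μ :=
    hG.bdd_smul 1 hZ.aestronglyMeasurable <| by
      filter_upwards [hind] with ω h
      rcases h with h | h <;> simp [h]
  have hcov : (∫ ω, Z ω • G ω ∂μ) - p • (∫ ω, G ω ∂μ) = ∫ ω, (Z ω - p) • G ω ∂μ := by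
    simp_rw [sub_smul]
    rw [integral_sub hZG (hG.fun_smul p), integral_smul]
  -- For `Z ω ∈ {0, 1}` and `p ∈ [0, 1]`, `|Z ω - p| = p + (1 - 2 * p) * Z ω`.
  have hle : ∀ᵐ ω ∂μ, ‖(Z ω - p) • G ω‖ ≤ (p + (1 - 2 * p) * Z ω) * K := by
    filter_upwards [hind, hbound] with ω h hGK
    rw [norm_smul, Real.norm_eq_abs]
    refine mul_le_mul (abs_le.2 ?_) hGK (norm_nonneg _) ?_ <;>
      rcases h with h | h <;> rw [h]
    · constructor <;> linarith
    · constructor <;> linarith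
    · linarith
    · linarith
  have hlin : Integrable (fun ω => p + (1 - 2 * p) * Z ω) μ :=
    (integrable_const p).add (hZint.const_mul _)
  rw [hcov]
  calc ‖∫ ω, (Z ω - p) • G ω ∂μ‖
      ≤ ∫ ω, (p + (1 - 2 * p) * Z ω) * K ∂μ :=
        norm_integral_le_of_norm_le (hlin.mul_const K) hle
    _ = (p + (1 - 2 * p) * p) * K := by
        rw [integral_mul_const, integral_add (integrable_const p) (hZint.const_mul _),
          integral_const_mul, ← hp]
        simp
    _ ≤ K / 2 := by nlinarith [mul_nonneg hK (sq_nonneg (2 * p - 1))]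
end
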